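/- Suppose H is a [3]-graph on n ≥ 69 vertices such that every pair of non-adjacent vertices u, v satisfies d_{∂H}(u) + d_{∂H}(v) ≥ n + 65, and H contains no Hamiltonian Berge cycle. Let C be a longest Berge cycle in H, with |V(C)| ∈ {n−1, n−2}, and let u ∈ V(H) − V(C). Then for any set Y ⊆ V(C) with |Y| ≤ 2 and d_C(y) ≥ n/4 + 18 for every y ∈ Y, there does not exist a Berge cycle C' in H with V(C) ∪ {u} − Y ⊆ V(C'). -/

import Mathlib

/-- Two vertices are adjacent in the hypergraph with edge set `H`
if some edge contains both of them. -/
def HAdj {V : Type*} (H : Finset (Finset V)) (u v : V) : Prop :=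
  u ≠ v ∧ ∃ e ∈ H, u ∈ e ∧ v ∈ e

/-- The degree of `u` in the 2-shadow `∂H`: the number of vertices adjacent to `u`. -/
noncomputable def shadowDeg {V : Type*} (H : Finset (Finset V)) (u : V) : ℕ :=
  {v | HAdj H u v}.ncard

/-- A `[3]`-graph: every edge has exactly 2 or 3 vertices. -/
def IsThreeGraph {V : Type*} (H : Finset (Finset V)) : Prop :=
  ∀ e ∈ H, e.card = 2 ∨ e.card = 3

/-- A Berge cycle of length `t` in the hypergraph with edge set `H`:
`t` distinct vertices `vtx i` and `t` distinct edges `edge i` (indices mod `t`)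
with `{vtx i, vtx (i+1)} ⊆ edge i` for every `i`. -/
structure BergeCycle {V : Type*} (H : Finset (Finset V)) (t : ℕ) where
  vtx : ZMod t → V
  edge : ZMod t → Finset V
  vtx_inj : Function.Injective vtx
  edge_inj : Function.Injective edge
  edge_mem : ∀ i, edge i ∈ H
  mem_fst : ∀ i, vtx i ∈ edge i
  mem_snd : ∀ i, vtx (i + 1) ∈ edge i

/-- `d_C(u)`: the number of vertices of the Berge cycle `C` adjacent to `u`. -/
noncomputable def BergeCycle.dC {V : Type*} {H : Finset (Finset V)} {t : ℕ}
    (C : BergeCycle H t) (u : V) : ℕ :=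
  {v | v ∈ Set.range C.vtx ∧ HAdj H u v}.ncard

/-- `H` contains a Hamiltonian Berge cycle, i.e. a Berge cycle whose
vertex set is all of `V`. -/
def HamiltonianBergeCycle {V : Type*} (H : Finset (Finset V)) : Prop :=
  ∃ (t : ℕ) (C : BergeCycle H t), Set.range C.vtx = Set.univ

/-- A set `U` of indices of vertices of the Berge cycle `C` is usable for `u`:
(1) for every `i ∈ U` there is an edge in `E(u, v_{i-1}) - {e_{i-2}}`;
(2) any two distinct `i, j ∈ U` are non-consecutive on `C`;
(3) for every pair of distinct `i, j ∈ U` there are distinct edges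
`e ∈ E(u, v_{i-1}) - {e_{i-2}}` and `e' ∈ E(u, v_{j-1}) - {e_{j-2}}`. -/
def Usable {V : Type*} {H : Finset (Finset V)} {t : ℕ} (C : BergeCycle H t) (u : V)
    (U : Set (ZMod t)) : Prop :=
  (∀ i ∈ U, ∃ e ∈ H, e ≠ C.edge (i - 2) ∧ u ∈ e ∧ C.vtx (i - 1) ∈ e) ∧
  (∀ i ∈ U, ∀ j ∈ U, i ≠ j → j ≠ i + 1 ∧ j ≠ i - 1) ∧
  (∀ i ∈ U, ∀ j ∈ U, i ≠ j → ∃ e ∈ H, ∃ e' ∈ H, e ≠ e' ∧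
    e ≠ C.edge (i - 2) ∧ u ∈ e ∧ C.vtx (i - 1) ∈ e ∧
    e' ≠ C.edge (j - 2) ∧ u ∈ e' ∧ C.vtx (j - 1) ∈ e')

/-- `CwBtw a b c` : on the cycle oriented clockwise, `b` lies strictly between
`a` and `c` on the clockwise arc from `a` to `c`. -/
def CwBtw {t : ℕ} (a b c : ZMod t) : Prop :=
  0 < (b - a).val ∧ (b - a).val < (c - a).val

/-- `e` is an `(i,j;k)`-bridge of the Berge cycle `C`. -/
def IsBridge {V : Type*} [DecidableEq V] {H : Finset (Finset V)} {t : ℕ}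
    (C : BergeCycle H t) (i j k : ZMod t) (e : Finset V) : Prop :=
  (CwBtw i k j ∧ ((e = C.edge (k + 1) ∧ e = {C.vtx i, C.vtx (k + 1), C.vtx (k + 2)}) ∨
                (e = C.edge (k - 1) ∧ e = {C.vtx j, C.vtx k, C.vtx (k - 1)}))) ∨
  (CwBtw j k i ∧ ((e = C.edge (k - 1) ∧ e = {C.vtx i, C.vtx k, C.vtx (k - 1)}) ∨
                (e = C.edge (k + 1) ∧ e = {C.vtx j, C.vtx (k + 1), C.vtx (k + 2)})))

/-- `R(v_i, v_j)`: the set of bridges produced by the pair `{v_i, v_j}`,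
i.e. all `(i,j;k)`-bridges over `k ∉ {i, j}`. -/
def RBridges {V : Type*} [DecidableEq V] {H : Finset (Finset V)} {t : ℕ}
    (C : BergeCycle H t) (i j : ZMod t) : Set (Finset V) :=
  {e | ∃ k : ZMod t, k ≠ i ∧ k ≠ j ∧ IsBridge C i j k e}


/-- Berge path with `s+1` vertices `p 0, ..., p s` and `s` edges `g 0, ..., g (s-1)`. -/
structure BPath {V : Type*} (H : Finset (Finset V)) (s : ℕ) (p : ℕ → V) (g : ℕ → Finset V) :
    Prop where
  pinj : ∀ k ≤ s, ∀ l ≤ s, p k = p l → k = l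
  ginj : ∀ k < s, ∀ l < s, g k = g l → k = l
  mem : ∀ k < s, g k ∈ H
  fst : ∀ k < s, p k ∈ g k
  snd : ∀ k < s, p (k + 1) ∈ g k

theorem close_adj {V : Type*} {H : Finset (Finset V)} {s : ℕ} {p : ℕ → V} {g : ℕ → Finset V}
    (hs : 1 ≤ s) (P : BPath H s p g) (e : Finset V) (he : e ∈ H) (h0 : p 0 ∈ e) (h1 : p s ∈ e)
    (hne : ∀ k < s, g k ≠ e) :
    ∃ C : BergeCycle H (s + 1), Set.range C.vtx = p '' Set.Iic s := by
  have hlt : ∀ z : ZMod (s + 1), z.val ≤ s := fun z => Nat.lt_succ_iff.mp (ZMod.val_lt z)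
  refine ⟨⟨fun z => p z.val, fun z => if z.val < s then g z.val else e, ?_, ?_, ?_, ?_, ?_⟩, ?_⟩
  · intro a b hab
    exact ZMod.val_injective _ (P.pinj _ (hlt a) _ (hlt b) hab)
  · intro a b hab
    apply ZMod.val_injective
    have ha := hlt a
    have hb := hlt b
    try dsimp only at hab
    split_ifs at hab with h1 h2 h2
    · exact P.ginj _ h1 _ h2 hab
    · exact absurd hab (hne _ h1)
    · exact absurd hab.symm (hne _ h2)
    · omega
  · intro i
    try dsimp only
    split_ifs with h
    · exact P.mem _ h
    · exact he
  · intro i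
    have hi := hlt i
    try dsimp only
    split_ifs with h
    · exact P.fst _ h
    · have : i.val = s := by omega
      rw [this]; exact h1
  · intro i
    have hi := hlt i
    have : Fact (1 < s + 1) := ⟨by omega⟩
    have hv : (i + 1).val = (i.val + 1) % (s + 1) := by
      rw [ZMod.val_add, ZMod.val_one]
    try dsimp only
    rw [hv]
    split_ifs with h
    · rw [Nat.mod_eq_of_lt (by omega)]
      exact P.snd _ h
    · have : i.val = s := by omega
      rw [this, Nat.mod_self]; exact h0
  · ext x
    constructor
    · rintro ⟨z, rfl⟩
      exact ⟨z.val, hlt z, rfl⟩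
    · rintro ⟨k, hk, rfl⟩
      refine ⟨(k : ZMod (s + 1)), ?_⟩
      try dsimp only
      rw [ZMod.val_natCast, Nat.mod_eq_of_lt (Nat.lt_succ_of_le hk)]

theorem close_cross {V : Type*} {H : Finset (Finset V)} {s : ℕ} {p : ℕ → V} {g : ℕ → Finset V}
    (P : BPath H s p g) (k : ℕ) (hk : k < s) (e h : Finset V) (he : e ∈ H) (hh : h ∈ H)
    (he0 : p 0 ∈ e) (he1 : p (k + 1) ∈ e) (hh0 : p k ∈ h) (hh1 : p s ∈ h)
    (hne : ∀ l < s, g l ≠ e) (hnh : ∀ l < s, g l ≠ h) (hneh : e ≠ h) :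
    ∃ C : BergeCycle H (s + 1), Set.range C.vtx = p '' Set.Iic s := by
  have P' : BPath H s (fun l => if l ≤ k then p l else p (s + k + 1 - l))
      (fun l => if l < k then g l else if l = k then h else g (s + k - l)) := by
    refine ⟨?_, ?_, ?_, ?_, ?_⟩
    · intro a ha b hb hab
      try dsimp only at hab
      split_ifs at hab with h1 h2 h2
      · exact P.pinj _ ha _ hb hab
      · have := P.pinj _ ha _ (by omega) hab
        omega
      · have := P.pinj _ (by omega) _ hb hab
        omega
      · have := P.pinj _ (by omega) _ (by omega) hab
        omega
    · intro a ha b hb hab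
      try dsimp only at hab
      split_ifs at hab with h1 h2 h3 h4 h5 h6 h7 h8
      · exact P.ginj _ ha _ hb hab
      · exact absurd hab (hnh _ ha)
      · have := P.ginj _ ha _ (by omega) hab
        omega
      · exact absurd hab.symm (hnh _ hb)
      · omega
      · exact absurd hab.symm (hnh _ (by omega))
      · have := P.ginj _ (by omega) _ hb hab
        omega
      · exact absurd hab (hnh _ (by omega))
      · have := P.ginj _ (by omega) _ (by omega) hab
        omega
    · intro a ha
      try dsimp only
      split_ifs
      · exact P.mem _ ha
      · exact hh
      · exact P.mem _ (by omega)
    · intro a ha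
      rcases lt_trichotomy a k with h1 | h1 | h1
      · simp only [if_pos h1, if_pos h1.le]
        exact P.fst _ ha
      · subst h1
        simpa using hh0
      · simp only [if_neg h1.not_gt, if_neg h1.not_ge, if_neg h1.ne']
        have := P.snd (s + k - a) (by omega)
        rwa [show s + k - a + 1 = s + k + 1 - a by omega] at this
    · intro a ha
      rcases lt_trichotomy a k with h1 | h1 | h1
      · simp only [if_pos h1, if_pos (show a + 1 ≤ k by omega)]
        exact P.snd _ ha
      · subst h1
        simp only [lt_irrefl, if_false, if_true, if_neg (show ¬ (a + 1 ≤ a) by omega)]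
        rwa [show s + a + 1 - (a + 1) = s by omega]
      · simp only [if_neg h1.not_gt, if_neg (show ¬ (a + 1 ≤ k) by omega), if_neg h1.ne']
        have := P.fst (s + k - a) (by omega)
        rwa [show s + k + 1 - (a + 1) = s + k - a by omega]
  have hend : (fun l => if l ≤ k then p l else p (s + k + 1 - l)) s = p (k + 1) := by
    try dsimp only
    rw [if_neg (by omega), show s + k + 1 - s = k + 1 by omega]
  obtain ⟨C, hC⟩ := close_adj (by omega) P' e he (by simpa using he0) (by rw [← hend] at he1; exact he1) (by
    intro l hl
    try dsimp only
    split_ifs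
    · exact hne _ hl
    · exact hneh.symm
    · exact hne _ (by omega))
  refine ⟨C, hC.trans ?_⟩
  ext x
  constructor
  · rintro ⟨l, hl, rfl⟩
    simp only [Set.mem_Iic] at hl
    try dsimp only
    split_ifs
    · exact ⟨l, hl, rfl⟩
    · exact ⟨_, by simp only [Set.mem_Iic]; omega, rfl⟩
  · rintro ⟨l, hl, rfl⟩
    simp only [Set.mem_Iic] at hl
    by_cases hlk : l ≤ k
    · exact ⟨l, hl, if_pos hlk⟩
    · refine ⟨s + k + 1 - l, by simp only [Set.mem_Iic]; omega, ?_⟩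
      try dsimp only
      rw [if_neg (by omega), show s + k + 1 - (s + k + 1 - l) = l by omega]

theorem bad_card {V : Type*} [DecidableEq V] {H : Finset (Finset V)} (h3 : IsThreeGraph H)
    {s : ℕ} (g : ℕ → Finset V) (hg : ∀ k < s, g k ∈ H) (x : V) (q : ℕ → V)
    (hq : ∀ k < s, ∀ l < s, q k = q l → k = l)
    (hc : ((Finset.range s).filter (fun l => x ∈ g l)).card ≤ 12) :
    ((Finset.range s).filter (fun k => q k ≠ x ∧ ∃ l < s, x ∈ g l ∧ q k ∈ g l)).card ≤ 24 := by
  set T := (Finset.range s).filter (fun l => x ∈ g l) with hT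
  have hsub : ((Finset.range s).filter (fun k => q k ≠ x ∧ ∃ l < s, x ∈ g l ∧ q k ∈ g l)).image q
      ⊆ T.biUnion (fun l => (g l).erase x) := by
    intro v hv
    simp only [Finset.mem_image, Finset.mem_filter, Finset.mem_range] at hv
    obtain ⟨k, ⟨hk, hkx, l, hl, hxl, hql⟩, rfl⟩ := hv
    simp only [Finset.mem_biUnion, hT, Finset.mem_filter, Finset.mem_range, Finset.mem_erase]
    exact ⟨l, ⟨hl, hxl⟩, hkx, hql⟩
  have hinj : ((Finset.range s).filter
      (fun k => q k ≠ x ∧ ∃ l < s, x ∈ g l ∧ q k ∈ g l)).card =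
      (((Finset.range s).filter
      (fun k => q k ≠ x ∧ ∃ l < s, x ∈ g l ∧ q k ∈ g l)).image q).card := by
    rw [Finset.card_image_of_injOn]
    intro a ha b hb hab
    simp only [Finset.coe_filter, Finset.mem_range, Set.mem_ofPred_eq] at ha hb
    exact hq _ ha.1 _ hb.1 hab
  rw [hinj]
  refine (Finset.card_le_card hsub).trans ?_
  refine (Finset.card_biUnion_le_card_mul T _ 2 ?_).trans (by omega)
  intro l hl
  simp only [hT, Finset.mem_filter, Finset.mem_range] at hl
  rw [Finset.card_erase_of_mem hl.2]
  rcases h3 _ (hg l hl.1) with h | h <;> omega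

theorem deg_bound {V : Type*} [Fintype V] [DecidableEq V] (H : Finset (Finset V))
    {s : ℕ} (p : ℕ → V) (pinj : ∀ k ≤ s, ∀ l ≤ s, p k = p l → k = l)
    (x : V) (A : Finset ℕ) (q : ℕ → V)
    (hA : ∀ k ≤ s, HAdj H x (p k) → ∃ a ∈ A, q a = p k) :
    shadowDeg H x + (s + 1) ≤ A.card + Fintype.card V := by
  classical
  have h1 : ((Finset.range (s + 1)).image p).card = s + 1 := by
    rw [Finset.card_image_of_injOn, Finset.card_range]
    intro a ha b hb hab
    simp only [Finset.coe_range, Set.mem_Iio] at ha hb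
    exact pinj _ (by omega) _ (by omega) hab
  have h2 : {v | HAdj H x v} ⊆
      ((A.image q ∪ (Finset.univ \ (Finset.range (s + 1)).image p) : Finset V) : Set V) := by
    intro v hv
    simp only [Finset.coe_union, Set.mem_union, Finset.mem_coe, Finset.mem_sdiff, Finset.mem_univ,
      true_and]
    by_cases h : v ∈ (Finset.range (s + 1)).image p
    · left
      simp only [Finset.mem_image, Finset.mem_range] at h ⊢
      obtain ⟨k, hk, rfl⟩ := h
      exact hA k (by omega) hv
    · exact Or.inr h
  have h3 : shadowDeg H x ≤ _ := Set.ncard_le_ncard h2 (Finset.finite_toSet _)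
  rw [Set.ncard_coe_finset] at h3
  have h4 := Finset.card_union_le (A.image q) (Finset.univ \ (Finset.range (s + 1)).image p)
  have h5 : (A.image q).card ≤ A.card := Finset.card_image_le
  have h6 := Finset.card_sdiff_add_card_eq_card (Finset.subset_univ ((Finset.range (s + 1)).image p))
  rw [Finset.card_univ] at h6
  omega

theorem HAdj.symm' {V : Type*} {H : Finset (Finset V)} {u v : V} (h : HAdj H u v) : HAdj H v u :=
  ⟨h.1.symm, h.2.imp fun _ h => ⟨h.1, h.2.2, h.2.1⟩⟩

theorem close_ore {V : Type*} [Fintype V] {n : ℕ} (hcard : Fintype.card V = n)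
    {H : Finset (Finset V)} (h3 : IsThreeGraph H) {s : ℕ} {p : ℕ → V} {g : ℕ → Finset V}
    (P : BPath H s p g) (hs : n ≤ s + 3) [DecidableEq V]
    (hnadj : ¬ HAdj H (p 0) (p s)) (hne : p 0 ≠ p s)
    (hdeg : n + 65 ≤ shadowDeg H (p 0) + shadowDeg H (p s))
    (hc0 : ((Finset.range s).filter (fun l => p 0 ∈ g l)).card ≤ 12)
    (hc1 : ((Finset.range s).filter (fun l => p s ∈ g l)).card ≤ 12) :
    ∃ C : BergeCycle H (s + 1), Set.range C.vtx = p '' Set.Iic s := by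
  classical
  set A := (Finset.range s).filter (fun k => HAdj H (p 0) (p (k + 1))) with hA
  set B := (Finset.range s).filter (fun k => HAdj H (p s) (p k)) with hB
  set X := (Finset.range s).filter
    (fun k => p (k + 1) ≠ p 0 ∧ ∃ l < s, p 0 ∈ g l ∧ p (k + 1) ∈ g l) with hX
  set Z := (Finset.range s).filter
    (fun k => p k ≠ p s ∧ ∃ l < s, p s ∈ g l ∧ p k ∈ g l) with hZ
  have dA : shadowDeg H (p 0) + (s + 1) ≤ A.card + Fintype.card V := by
    refine deg_bound H p P.pinj _ A (fun k => p (k + 1)) ?_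
    intro k hk hadj
    have hk0 : k ≠ 0 := by
      rintro rfl; exact hadj.1 rfl
    refine ⟨k - 1, ?_, ?_⟩
    · simp only [hA, Finset.mem_filter, Finset.mem_range]
      rw [show k - 1 + 1 = k by omega]
      exact ⟨by omega, hadj⟩
    · try dsimp only
      rw [show k - 1 + 1 = k by omega]
  have dB : shadowDeg H (p s) + (s + 1) ≤ B.card + Fintype.card V := by
    refine deg_bound H p P.pinj _ B p ?_
    intro k hk hadj
    have hk0 : k ≠ s := by
      rintro rfl; exact hadj.1 rfl
    refine ⟨k, ?_, rfl⟩
    simp only [hB, Finset.mem_filter, Finset.mem_range]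
    exact ⟨by omega, hadj⟩
  have cX : X.card ≤ 24 := bad_card h3 g P.mem (p 0) (fun k => p (k + 1))
    (fun k hk l hl h => by have := P.pinj _ (by omega) _ (by omega) h; omega) hc0
  have cZ : Z.card ≤ 24 := bad_card h3 g P.mem (p s) p
    (fun k hk l hl h => P.pinj _ (by omega) _ (by omega) h) hc1
  have cU : (A ∪ B).card ≤ s := by
    have : A ∪ B ⊆ Finset.range s :=
      Finset.union_subset (Finset.filter_subset _ _) (Finset.filter_subset _ _)
    simpa using Finset.card_le_card this
  have cI := Finset.card_union_add_card_inter A B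
  have cXZ := Finset.card_union_le X Z
  obtain ⟨k, hk, hkn⟩ : ∃ k ∈ A ∩ B, k ∉ X ∪ Z := by
    apply Finset.exists_mem_notMem_of_card_lt_card
    omega
  simp only [Finset.mem_inter, Finset.mem_union, hA, hB, hX, hZ, Finset.mem_filter,
    Finset.mem_range, not_or] at hk hkn
  obtain ⟨⟨hks, hadj0⟩, _, hadj1⟩ := hk
  obtain ⟨hx, hz⟩ := hkn
  obtain ⟨hn0, e, heH, he0, he1⟩ := hadj0
  obtain ⟨hn1, h, hhH, hh1, hh0⟩ := hadj1
  refine close_cross P k hks e h heH hhH he0 he1 hh0 hh1 ?_ ?_ ?_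
  · rintro l hl rfl
    exact hx ⟨hks, hn0.symm, l, hl, he0, he1⟩
  · rintro l hl rfl
    exact hz ⟨hks, hn1.symm, l, hl, hh1, hh0⟩
  · rintro rfl
    exact hnadj ⟨hne, e, heH, he0, hh1⟩

theorem indep_pair {α : Type*} [DecidableEq α] (S : Finset α) (out : α → Finset α)
    (ho : ∀ i ∈ S, (out i).card ≤ 3) (hS : 8 ≤ S.card) :
    ∃ i ∈ S, ∃ j ∈ S, i ≠ j ∧ j ∉ out i ∧ i ∉ out j := by
  by_contra hcon
  push Not at hcon
  set T := S.biUnion (fun i => (out i).image (fun j => (i, j))) with hT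
  have hsub : S.offDiag ⊆ T ∪ T.image Prod.swap := by
    rintro ⟨i, j⟩ hij
    rw [Finset.mem_offDiag] at hij
    obtain ⟨hi, hj, hne⟩ := hij
    dsimp only at hi hj hne
    simp only [hT, Finset.mem_union, Finset.mem_biUnion, Finset.mem_image, Prod.mk.injEq]
    by_cases h : j ∈ out i
    · exact Or.inl ⟨i, hi, j, h, rfl, rfl⟩
    · exact Or.inr ⟨(j, i), ⟨j, hj, i, hcon i hi j hj hne h, rfl⟩, rfl⟩
  have h1 : T.card ≤ S.card * 3 := Finset.card_biUnion_le_card_mul _ _ _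
    (fun i hi => Finset.card_image_le.trans (ho i hi))
  have h2 : (T.image Prod.swap).card ≤ T.card := Finset.card_image_le
  have h4 := (Finset.card_le_card hsub).trans (Finset.card_union_le _ _)
  rw [Finset.offDiag_card] at h4
  have h5 : S.card * 8 ≤ S.card * S.card := Nat.mul_le_mul_left _ hS
  omega

theorem build_path {V : Type*} {H : Finset (Finset V)} {s : ℕ} (hs : 2 ≤ s) (C : BergeCycle H s)
    (i j : ZMod s) (hij : i ≠ j) (y : V) (hy : y ∉ Set.range C.vtx) (fi fj : Finset V)
    (hfi : fi ∈ H) (hfj : fj ∈ H) (hyi : y ∈ fi) (hyj : y ∈ fj) (hvi : C.vtx i ∈ fi)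
    (hvj : C.vtx j ∈ fj) (hff : fi ≠ fj) (hei : ∀ l, fi = C.edge l → l = i)
    (hej : ∀ l, fj = C.edge l → l = j) :
    ∃ p g, BPath H s p g ∧ p 0 = C.vtx (i + 1) ∧ p s = C.vtx (j + 1) ∧
      p '' Set.Iic s = insert y (Set.range C.vtx) ∧
      ∀ k < s, g k = fi ∨ g k = fj ∨ ∃ l, l ≠ i ∧ l ≠ j ∧ g k = C.edge l := by
  have : NeZero s := ⟨by omega⟩
  obtain ⟨q, hq, hqj⟩ : ∃ q < s, j = i + 1 + (q : ZMod s) :=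
    ⟨(j - i - 1).val, ZMod.val_lt _, by rw [ZMod.natCast_zmod_val]; ring⟩
  have hcast : ∀ k < s, ∀ l < s, i + 1 + (k : ZMod s) = i + 1 + (l : ZMod s) → k = l := by
    intro k hk l hl h
    have h := add_left_cancel h
    rw [ZMod.natCast_eq_natCast_iff'] at h
    rwa [Nat.mod_eq_of_lt hk, Nat.mod_eq_of_lt hl] at h
  have hi : i = i + 1 + ((s - 1 : ℕ) : ZMod s) := by
    rw [Nat.cast_sub (by omega)]; simp
  have hqs : q + 1 < s := by
    rcases Nat.lt_or_ge (q + 1) s with h | h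
    · exact h
    · have : q = s - 1 := by omega
      rw [this, ← hi] at hqj
      exact absurd hqj.symm hij
  obtain ⟨a, ha⟩ : ∃ a : ℕ → V, ∀ k, a k = C.vtx (i + 1 + (k : ZMod s)) := ⟨_, fun _ => rfl⟩
  obtain ⟨E, hE⟩ : ∃ E : ℕ → Finset V, ∀ k, E k = C.edge (i + 1 + (k : ZMod s)) :=
    ⟨_, fun _ => rfl⟩
  have ainj : ∀ k < s, ∀ l < s, a k = a l → k = l := fun k hk l hl h =>
    hcast k hk l hl (C.vtx_inj (by rwa [ha, ha] at h))
  have Einj : ∀ k < s, ∀ l < s, E k = E l → k = l := fun k hk l hl h =>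
    hcast k hk l hl (C.edge_inj (by rwa [hE, hE] at h))
  have EH : ∀ k, E k ∈ H := fun k => by rw [hE]; exact C.edge_mem _
  have E1 : ∀ k, a k ∈ E k := fun k => by rw [hE, ha]; exact C.mem_fst _
  have E2 : ∀ k, a (k + 1) ∈ E k := fun k => by
    rw [hE, ha]
    have := C.mem_snd (i + 1 + (k : ZMod s))
    rwa [add_assoc (i + 1), ← Nat.cast_succ] at this
  have ay : ∀ k, a k ≠ y := fun k h => hy ⟨_, by rw [← ha]; exact h⟩
  have hai : a (s - 1) ∈ fi := by rw [ha, ← hi]; exact hvi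
  have haj : a q ∈ fj := by rw [ha, ← hqj]; exact hvj
  have Ei : ∀ k < s, E k = fi → k = s - 1 := fun k hk h => by
    have := hei _ (by rw [← h, hE])
    apply hcast _ hk _ (by omega)
    rw [← hi]; exact this
  have Ej : ∀ k < s, E k = fj → k = q := fun k hk h => by
    have := hej _ (by rw [← h, hE])
    apply hcast _ hk _ (by omega)
    rw [← hqj]; exact this
  have Enot : ∀ k < s, k ≠ q → k ≠ s - 1 → ∃ l, l ≠ i ∧ l ≠ j ∧ E k = C.edge l := by
    intro k hk h1 h2
    refine ⟨_, ?_, ?_, hE k⟩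
    · intro h
      exact h2 (hcast _ hk _ (by omega) (by rw [← hi]; exact h))
    · intro h
      exact h1 (hcast _ hk _ (by omega) (by rw [← hqj]; exact h))
  obtain ⟨p, p1, p2, p3⟩ : ∃ p : ℕ → V, (∀ k ≤ q, p k = a k) ∧ p (q + 1) = y ∧
      (∀ k, q + 1 < k → p k = a (s + q + 1 - k)) := by
    refine ⟨fun k => if k ≤ q then a k else if k = q + 1 then y else a (s + q + 1 - k), ?_, ?_, ?_⟩
    · intro k hk
      exact if_pos hk
    · simp
    · intro k hk
      simp only [if_neg (show ¬ k ≤ q by omega), if_neg (show ¬ k = q + 1 by omega)]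
  obtain ⟨g, g1, g2, g3, g4⟩ : ∃ g : ℕ → Finset V, (∀ k < q, g k = E k) ∧ g q = fj ∧
      g (q + 1) = fi ∧ (∀ k, q + 1 < k → g k = E (s + q - k)) := by
    refine ⟨fun k => if k < q then E k else if k = q then fj else if k = q + 1 then fi else
      E (s + q - k), ?_, ?_, ?_, ?_⟩
    · intro k hk
      exact if_pos hk
    · simp
    · simp
    · intro k hk
      simp only [if_neg (show ¬ k < q by omega), if_neg (show ¬ k = q by omega),
        if_neg (show ¬ k = q + 1 by omega)]
  have pc : ∀ k : ℕ, k ≤ q ∨ k = q + 1 ∨ q + 1 < k := by intro k; omega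
  have gc : ∀ k : ℕ, k < q ∨ k = q ∨ k = q + 1 ∨ q + 1 < k := by intro k; omega
  refine ⟨p, g, ⟨?_, ?_, ?_, ?_, ?_⟩, ?_, ?_, ?_, ?_⟩
  · intro k hk l hl h
    rcases pc k with h1 | h1 | h1 <;> rcases pc l with h2 | h2 | h2
    · rw [p1 k h1, p1 l h2] at h
      exact ainj _ (by omega) _ (by omega) h
    · rw [p1 k h1, h2, p2] at h
      exact absurd h (ay _)
    · rw [p1 k h1, p3 l h2] at h
      have := ainj _ (by omega) _ (by omega) h
      omega
    · rw [p1 l h2, h1, p2] at h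
      exact absurd h.symm (ay _)
    · omega
    · rw [p3 l h2, h1, p2] at h
      exact absurd h.symm (ay _)
    · rw [p3 k h1, p1 l h2] at h
      have := ainj _ (by omega) _ (by omega) h
      omega
    · rw [p3 k h1, h2, p2] at h
      exact absurd h (ay _)
    · rw [p3 k h1, p3 l h2] at h
      have := ainj _ (by omega) _ (by omega) h
      omega
  · intro k hk l hl h
    rcases gc k with h1 | h1 | h1 | h1 <;> rcases gc l with h2 | h2 | h2 | h2
    · rw [g1 k h1, g1 l h2] at h
      exact Einj _ hk _ hl h
    · rw [g1 k h1, h2, g2] at h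
      have := Ej _ (by omega) h
      omega
    · rw [g1 k h1, h2, g3] at h
      have := Ei _ (by omega) h
      omega
    · rw [g1 k h1, g4 l h2] at h
      have := Einj _ (by omega) _ (by omega) h
      omega
    · rw [g1 l h2, h1, g2] at h
      have := Ej _ (by omega) h.symm
      omega
    · omega
    · rw [h1, h2, g2, g3] at h
      exact absurd h.symm hff
    · rw [g4 l h2, h1, g2] at h
      have := Ej _ (by omega) h.symm
      omega
    · rw [g1 l h2, h1, g3] at h
      have := Ei _ (by omega) h.symm
      omega
    · rw [h1, h2, g2, g3] at h
      exact absurd h hff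
    · omega
    · rw [g4 l h2, h1, g3] at h
      have := Ei _ (by omega) h.symm
      omega
    · rw [g4 k h1, g1 l h2] at h
      have := Einj _ (by omega) _ (by omega) h
      omega
    · rw [g4 k h1, h2, g2] at h
      have := Ej _ (by omega) h
      omega
    · rw [g4 k h1, h2, g3] at h
      have := Ei _ (by omega) h
      omega
    · rw [g4 k h1, g4 l h2] at h
      have := Einj _ (by omega) _ (by omega) h
      omega
  · intro k hk
    rcases gc k with h1 | h1 | h1 | h1
    · rw [g1 k h1]; exact EH _
    · rw [h1, g2]; exact hfj
    · rw [h1, g3]; exact hfi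
    · rw [g4 k h1]; exact EH _
  · intro k hk
    rcases gc k with h1 | h1 | h1 | h1
    · rw [g1 k h1, p1 k h1.le]; exact E1 _
    · rw [h1, g2, p1 q le_rfl]; exact haj
    · rw [h1, g3, p2]; exact hyi
    · rw [g4 k h1, p3 k h1, show s + q + 1 - k = s + q - k + 1 by omega]; exact E2 _
  · intro k hk
    rcases gc k with h1 | h1 | h1 | h1
    · rw [g1 k h1, p1 (k + 1) h1]; exact E2 _
    · rw [h1, g2, p2]; exact hyj
    · rw [h1, g3, p3 _ (by omega), show s + q + 1 - (q + 1 + 1) = s - 1 by omega]; exact hai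
    · rw [g4 k h1, p3 (k + 1) (by omega), show s + q + 1 - (k + 1) = s + q - k by omega]
      exact E1 _
  · rw [p1 0 (by omega), ha]; simp
  · rw [p3 s hqs, show s + q + 1 - s = q + 1 by omega, ha, hqj]
    push_cast
    rw [add_assoc (i + 1)]
  · ext x
    constructor
    · rintro ⟨k, hk, rfl⟩
      rcases pc k with h1 | h1 | h1
      · rw [p1 k h1, ha]; exact Or.inr ⟨_, rfl⟩
      · rw [h1, p2]; exact Or.inl rfl
      · rw [p3 k h1, ha]; exact Or.inr ⟨_, rfl⟩
    · rintro (rfl | ⟨z, rfl⟩)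
      · exact ⟨q + 1, by simp only [Set.mem_Iic]; omega, p2⟩
      · obtain ⟨m, hm, hmz⟩ : ∃ m < s, z = i + 1 + (m : ZMod s) :=
          ⟨(z - i - 1).val, ZMod.val_lt _, by rw [ZMod.natCast_zmod_val]; ring⟩
        rw [hmz, ← ha]
        by_cases hmq : m ≤ q
        · exact ⟨m, by simp only [Set.mem_Iic]; omega, p1 m hmq⟩
        · refine ⟨s + q + 1 - m, by simp only [Set.mem_Iic]; omega, ?_⟩
          rw [p3 _ (by omega), show s + q + 1 - (s + q + 1 - m) = m by omega]
  · intro k hk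
    rcases gc k with h1 | h1 | h1 | h1
    · rw [g1 k h1]; exact Or.inr (Or.inr (Enot _ hk (by omega) (by omega)))
    · rw [h1, g2]; exact Or.inr (Or.inl rfl)
    · rw [h1, g3]; exact Or.inl rfl
    · rw [g4 k h1]; exact Or.inr (Or.inr (Enot _ (by omega) (by omega) (by omega)))

theorem four {V : Type*} {H : Finset (Finset V)} (h3 : IsThreeGraph H) {e : Finset V} (he : e ∈ H)
    {a b c d : V} (ha : a ∈ e) (hb : b ∈ e) (hc : c ∈ e) (hd : d ∈ e) (hab : a ≠ b) (hac : a ≠ c)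
    (hbc : b ≠ c) : d = a ∨ d = b ∨ d = c := by
  classical
  by_contra h
  push Not at h
  have hsub : ({d, a, b, c} : Finset V) ⊆ e := by
    intro x hx
    simp only [Finset.mem_insert, Finset.mem_singleton] at hx
    rcases hx with rfl | rfl | rfl | rfl <;> assumption
  have hcard : ({d, a, b, c} : Finset V).card = 4 := by
    rw [Finset.card_insert_of_notMem, Finset.card_insert_of_notMem, Finset.card_insert_of_notMem,
      Finset.card_singleton]
    · simpa using hbc
    · simp [hab, hac]
    · simp [h.1, h.2.1, h.2.2]
  have := Finset.card_le_card hsub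
  rcases h3 e he with h | h <;> omega

theorem insertion {V : Type*} [Fintype V] {n : ℕ} (hn : 69 ≤ n) (hcard : Fintype.card V = n)
    {H : Finset (Finset V)} (h3 : IsThreeGraph H)
    (hOre : ∀ u v : V, u ≠ v → ¬ HAdj H u v → n + 65 ≤ shadowDeg H u + shadowDeg H v)
    {s : ℕ} (hs : n ≤ s + 3) (C : BergeCycle H s) (y : V) (hy : y ∉ Set.range C.vtx)
    (hd : n + 68 ≤ 4 * {v | v ∈ Set.range C.vtx ∧ HAdj H y v}.ncard) :
    ∃ C' : BergeCycle H (s + 1), Set.range C'.vtx = insert y (Set.range C.vtx) := by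
  classical
  have : NeZero s := ⟨by omega⟩
  have : Fact (1 < s) := ⟨by omega⟩
  have one0 : (1 : ZMod s) ≠ 0 := one_ne_zero
  have hsn : s ≤ n := by
    have := Fintype.card_le_of_injective C.vtx C.vtx_inj
    rwa [ZMod.card, hcard] at this
  have hyv : ∀ i, y ≠ C.vtx i := fun i h => hy ⟨i, h.symm⟩
  have vne : ∀ i, C.vtx i ≠ C.vtx (i + 1) := fun i h => by
    have := C.vtx_inj h
    exact one0 (by simpa using this)
  set D : Finset (ZMod s) := Finset.univ.filter (fun i => HAdj H y (C.vtx i)) with hD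
  have hDc : n + 68 ≤ 4 * D.card := by
    have : {v | v ∈ Set.range C.vtx ∧ HAdj H y v} ⊆ ((D.image C.vtx : Finset V) : Set V) := by
      rintro v ⟨⟨i, rfl⟩, hv⟩
      simp only [Finset.coe_image, Set.mem_image, Finset.mem_coe, hD, Finset.mem_filter,
        Finset.mem_univ, true_and]
      exact ⟨i, hv, rfl⟩
    have h1 := Set.ncard_le_ncard this (Finset.finite_toSet _)
    rw [Set.ncard_coe_finset] at h1
    have h2 : (D.image C.vtx).card ≤ D.card := Finset.card_image_le
    omega
  set N : Finset (ZMod s) := Finset.univ.filter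
    (fun i => ∃ e ∈ H, y ∈ e ∧ C.vtx i ∈ e ∧ e ≠ C.edge (i - 1)) with hN
  have hDN : D ⊆ N ∪ N.image (fun i => i + 1) := by
    intro i hi
    simp only [hD, Finset.mem_filter, Finset.mem_univ, true_and] at hi
    obtain ⟨_, e, he, hye, hve⟩ := hi
    simp only [Finset.mem_union, Finset.mem_image, hN, Finset.mem_filter, Finset.mem_univ,
      true_and]
    by_cases h : e = C.edge (i - 1)
    · right
      refine ⟨i - 1, ⟨e, he, hye, ?_, ?_⟩, by ring⟩
      · rw [h]; exact C.mem_fst _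
      · intro h'
        have := C.edge_inj (h.symm.trans h')
        apply one0
        linear_combination this
    · exact Or.inl ⟨e, he, hye, hve, h⟩
  have hNc : n + 68 ≤ 8 * N.card := by
    have h1 := (Finset.card_le_card hDN).trans (Finset.card_union_le _ _)
    have h2 : (N.image (fun i => i + 1)).card ≤ N.card := Finset.card_image_le
    omega
  have hex : ∀ i, ∃ e : Finset V, i ∈ N → e ∈ H ∧ y ∈ e ∧ C.vtx i ∈ e ∧ e ≠ C.edge (i - 1) := by
    intro i
    by_cases hi : i ∈ N
    · have hi' := hi
      simp only [hN, Finset.mem_filter, Finset.mem_univ, true_and] at hi'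
      obtain ⟨e, he⟩ := hi'
      exact ⟨e, fun _ => he⟩
    · exact ⟨∅, fun h => absurd h hi⟩
  choose f hf using hex
  have hfe : ∀ i ∈ N, ∀ l, f i = C.edge l → l = i := by
    intro i hi l hl
    obtain ⟨hH, hyf, hvf, hne⟩ := hf i hi
    have h1 := C.mem_fst l
    have h2 := C.mem_snd l
    rw [← hl] at h1 h2
    rcases four h3 hH hyf h1 h2 hvf (hyv _) (hyv _) (vne _) with h | h | h
    · exact absurd h.symm (hyv _)
    · exact (C.vtx_inj h).symm
    · have := C.vtx_inj h
      exfalso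
      apply hne
      rw [hl, this]
      congr 1
      ring
  -- low multiplicity vertices
  set c : ZMod s → ℕ := fun i => (Finset.univ.filter (fun k => C.vtx (i + 1) ∈ C.edge k)).card
    with hc
  have csum : ∑ i, c i ≤ 3 * s := by
    have h1 : ∑ i, c i = ∑ k, (Finset.univ.filter (fun i => C.vtx (i + 1) ∈ C.edge k)).card := by
      simp only [hc, Finset.card_filter]
      exact Finset.sum_comm
    rw [h1]
    have h2 : ∀ k ∈ (Finset.univ : Finset (ZMod s)),
        (Finset.univ.filter (fun i => C.vtx (i + 1) ∈ C.edge k)).card ≤ 3 := by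
      intro k _
      have : (Finset.univ.filter (fun i => C.vtx (i + 1) ∈ C.edge k)).card ≤ (C.edge k).card := by
        apply Finset.card_le_card_of_injOn (fun i => C.vtx (i + 1))
        · intro i hi
          simpa using hi
        · intro a _ b _ hab
          exact add_right_cancel (C.vtx_inj hab)
      rcases h3 _ (C.edge_mem k) with h | h <;> omega
    have := Finset.sum_le_card_nsmul _ _ 3 h2
    rw [Finset.card_univ, ZMod.card, smul_eq_mul] at this
    omega
  have c2 : ∀ i, 2 ≤ c i := by
    intro i
    have hsub : ({i, i + 1} : Finset (ZMod s)) ⊆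
        Finset.univ.filter (fun k => C.vtx (i + 1) ∈ C.edge k) := by
      intro k hk
      simp only [Finset.mem_insert, Finset.mem_singleton] at hk
      simp only [Finset.mem_filter, Finset.mem_univ, true_and]
      rcases hk with rfl | rfl
      · exact C.mem_snd _
      · exact C.mem_fst _
    have h1 := Finset.card_le_card hsub
    rwa [Finset.card_pair (by simpa using one0.symm)] at h1
  set S := N.filter (fun i => c i ≤ 10) with hS
  set T := N.filter (fun i => ¬ c i ≤ 10) with hT
  have hST : S.card + T.card = N.card := Finset.card_filter_add_card_filter_not _
  have hTc : 9 * T.card ≤ s := by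
    have h1 : ∀ i ∈ (Finset.univ : Finset (ZMod s)), (2 + if i ∈ T then 9 else 0) ≤ c i := by
      intro i _
      split_ifs with h
      · have := (Finset.mem_filter.mp h).2
        omega
      · simpa using c2 i
    have h2 := Finset.sum_le_sum h1
    rw [Finset.sum_add_distrib, Finset.sum_const, Finset.card_univ, ZMod.card,
      Finset.sum_ite_mem, Finset.univ_inter, Finset.sum_const, smul_eq_mul, smul_eq_mul] at h2
    omega
  have hS8 : 8 ≤ S.card := by omega
  -- conflict digraph
  obtain ⟨i, hiS, j, hjS, hij, hout1, hout2⟩ := indep_pair S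
    (fun i => {i + 1} ∪ (Finset.univ.filter (fun j => j ≠ i ∧ C.vtx j ∈ f i) ∪
      Finset.univ.filter (fun j => j ≠ i ∧ j ≠ i + 1 ∧ C.vtx (j + 1) ∈ C.edge (i + 1)))) (by
    intro i hi
    have hiN := (Finset.mem_filter.mp hi).1
    obtain ⟨hH, hyf, hvf, hne⟩ := hf i hiN
    have k1 : (Finset.univ.filter (fun j => j ≠ i ∧ C.vtx j ∈ f i)).card ≤ 1 := by
      rw [Finset.card_le_one]
      intro a ha b hb
      simp only [Finset.mem_filter, Finset.mem_univ, true_and] at ha hb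
      rcases four h3 hH hyf hvf ha.2 hb.2 (hyv _) (hyv _) (fun h => ha.1 (C.vtx_inj h).symm)
        with h | h | h
      · exact absurd h.symm (hyv _)
      · exact absurd (C.vtx_inj h) hb.1
      · exact (C.vtx_inj h).symm
    have k2 : (Finset.univ.filter
        (fun j => j ≠ i ∧ j ≠ i + 1 ∧ C.vtx (j + 1) ∈ C.edge (i + 1))).card ≤ 1 := by
      rw [Finset.card_le_one]
      intro a ha b hb
      simp only [Finset.mem_filter, Finset.mem_univ, true_and] at ha hb
      rcases four h3 (C.edge_mem (i + 1)) (C.mem_fst _) (C.mem_snd _) ha.2.2 hb.2.2 (vne _)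
        (fun h => ha.1 (add_right_cancel (C.vtx_inj h)).symm)
        (fun h => ha.2.1 (add_right_cancel (C.vtx_inj h)).symm) with h | h | h
      · exact absurd (add_right_cancel (C.vtx_inj h)) hb.1
      · exact absurd (add_right_cancel (C.vtx_inj h)) hb.2.1
      · exact (add_right_cancel (C.vtx_inj h)).symm
    refine (Finset.card_union_le _ _).trans ?_
    have k3 := Finset.card_union_le (Finset.univ.filter (fun j => j ≠ i ∧ C.vtx j ∈ f i))
      (Finset.univ.filter (fun j => j ≠ i ∧ j ≠ i + 1 ∧ C.vtx (j + 1) ∈ C.edge (i + 1)))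
    rw [Finset.card_singleton]
    omega) hS8
  obtain ⟨hiN, hic⟩ := Finset.mem_filter.mp hiS
  obtain ⟨hjN, hjc⟩ := Finset.mem_filter.mp hjS
  simp only [Finset.mem_union, Finset.mem_singleton, Finset.mem_filter, Finset.mem_univ, true_and,
    not_or, not_and] at hout1 hout2
  obtain ⟨hj1, hfj', hej'⟩ := hout1
  obtain ⟨hi1, hfi', hei'⟩ := hout2
  have hej := hej' hij.symm hj1
  have hei := hei' hij hi1
  obtain ⟨fiH, yfi, vfi, _⟩ := hf i hiN
  obtain ⟨fjH, yfj, vfj, _⟩ := hf j hjN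
  have hff : f i ≠ f j := fun h => hfj' hij.symm (by rw [h]; exact vfj)
  obtain ⟨p, g, P, p0, ps, prange, gall⟩ := build_path (by omega) C i j hij y hy (f i) (f j) fiH fjH
    yfi yfj vfi vfj hff (hfe i hiN) (hfe j hjN)
  rw [← prange]
  have hends : C.vtx (i + 1) ≠ C.vtx (j + 1) := fun h => hij (add_right_cancel (C.vtx_inj h))
  -- no path edge contains both ends
  have hnoe : ∀ k < s, ¬ (C.vtx (i + 1) ∈ g k ∧ C.vtx (j + 1) ∈ g k) := by
    rintro k hk ⟨h1, h2⟩
    have n1 : C.vtx i ≠ C.vtx (j + 1) := fun h => hi1 (C.vtx_inj h)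
    have n2 : C.vtx j ≠ C.vtx (i + 1) := fun h => hj1 (C.vtx_inj h)
    rcases gall k hk with h | h | ⟨l, hli, hlj, h⟩
    · rw [h] at h1 h2
      rcases four h3 fiH yfi vfi h1 h2 (hyv _) (hyv _) (vne _) with h | h | h
      · exact hyv _ h.symm
      · exact n1 h.symm
      · exact hends h.symm
    · rw [h] at h1 h2
      rcases four h3 fjH yfj vfj h2 h1 (hyv _) (hyv _) (vne _) with h | h | h
      · exact hyv _ h.symm
      · exact n2 h.symm
      · exact hends h
    · rw [h] at h1 h2
      by_cases e1 : l = i + 1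
      · rw [e1] at h2; exact hej h2
      by_cases e2 : l = j + 1
      · rw [e2] at h1; exact hei h1
      rcases four h3 (C.edge_mem l) (C.mem_fst l) (C.mem_snd l) h1 h2 (vne _)
        (fun h => e1 (C.vtx_inj h)) (fun h => hli (add_right_cancel (C.vtx_inj h))) with h | h | h
      · exact e2 (C.vtx_inj h).symm
      · exact hlj (add_right_cancel (C.vtx_inj h)).symm
      · exact hends h.symm
  have hcount : ∀ m : ZMod s, c m ≤ 10 →
      ((Finset.range s).filter (fun l => C.vtx (m + 1) ∈ g l)).card ≤ 12 := by
    intro m hm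
    have h1 : ((Finset.range s).filter (fun l => C.vtx (m + 1) ∈ g l)).card ≤
        ((Finset.univ.filter (fun k => C.vtx (m + 1) ∈ C.edge k)).image C.edge ∪
          {f i, f j}).card := by
      apply Finset.card_le_card_of_injOn g
      · intro l hl
        simp only [Finset.coe_filter, Finset.mem_range, Set.mem_ofPred_eq] at hl
        simp only [Finset.coe_union, Set.mem_union, Finset.mem_coe, Finset.mem_image,
          Finset.mem_filter, Finset.mem_univ, true_and, Finset.mem_insert, Finset.mem_singleton]
        rcases gall l hl.1 with h | h | ⟨k, _, _, h⟩
        · exact Or.inr (Or.inl h)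
        · exact Or.inr (Or.inr h)
        · exact Or.inl ⟨k, by rw [← h]; exact hl.2, h.symm⟩
      · intro a ha b hb hab
        simp only [Finset.coe_filter, Finset.mem_range, Set.mem_ofPred_eq] at ha hb
        exact P.ginj _ ha.1 _ hb.1 hab
    have h2 := Finset.card_union_le
      ((Finset.univ.filter (fun k => C.vtx (m + 1) ∈ C.edge k)).image C.edge) {f i, f j}
    have h4 : ((Finset.univ.filter (fun k => C.vtx (m + 1) ∈ C.edge k)).image C.edge).card ≤ c m :=
      Finset.card_image_le
    have h5 : ({f i, f j} : Finset (Finset V)).card ≤ 2 := Finset.card_le_two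
    omega
  by_cases hadj : HAdj H (p 0) (p s)
  · obtain ⟨_, e, he, h0, h1⟩ := hadj
    refine close_adj (by omega) P e he h0 h1 ?_
    rintro k hk rfl
    exact hnoe k hk ⟨by rwa [p0] at h0, by rwa [ps] at h1⟩
  · have hne : p 0 ≠ p s := by rw [p0, ps]; exact hends
    refine close_ore hcard h3 P hs hadj hne (hOre _ _ hne hadj) ?_ ?_
    · rw [p0]; exact hcount i hic
    · rw [ps]; exact hcount j hjc

/-- Claim 6: for a longest Berge cycle `C`, `u ∉ V(C)`, and any
`Y ⊆ V(C)` with `|Y| ≤ 2` all of whose vertices have `d_C(y) ≥ n/4 + 18`, there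
is no Berge cycle `C'` with `V(C) ∪ {u} - Y ⊆ V(C')`. -/
theorem stmt14 {V : Type*} [Fintype V] (n : ℕ) (hn : 69 ≤ n)
    (hcard : Fintype.card V = n) (H : Finset (Finset V)) (h3 : IsThreeGraph H)
    (hOre : ∀ u v : V, u ≠ v → ¬ HAdj H u v →
      n + 65 ≤ shadowDeg H u + shadowDeg H v)
    (hnoham : ¬ HamiltonianBergeCycle H)
    {t : ℕ} (C : BergeCycle H t)
    (hlong : ∀ (t' : ℕ) (C' : BergeCycle H t'), t' ≤ t)
    (ht : t = n - 1 ∨ t = n - 2)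
    (u : V) (hu : u ∉ Set.range C.vtx)
    (Y : Set V) (hYsub : Y ⊆ Set.range C.vtx) (hYcard : Y.ncard ≤ 2)
    (hYdeg : ∀ y ∈ Y, (n : ℚ) / 4 + 18 ≤ (C.dC y : ℚ)) :
    ¬ ∃ (t' : ℕ) (C' : BergeCycle H t'),
      (Set.range C.vtx ∪ {u}) \ Y ⊆ Set.range C'.vtx := by
  classical
  have ncr : ∀ (r : ℕ) (B : BergeCycle H r), (Set.range B.vtx).ncard = r := by
    intro r B
    rw [← Set.image_univ, Set.ncard_image_of_injective _ B.vtx_inj, Set.ncard_univ, Nat.card_zmod]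
  have hbig : (Set.range C.vtx ∪ {u}).ncard = t + 1 := by
    rw [Set.union_singleton, Set.ncard_insert_of_notMem hu, ncr]
  have key : ∀ k : ℕ, ∀ (r : ℕ) (B : BergeCycle H r),
      (Set.range C.vtx ∪ {u}) \ Y ⊆ Set.range B.vtx → (Y \ Set.range B.vtx).ncard = k → False := by
    intro k
    induction k with
    | zero =>
      intro r B hsub hk
      rw [Set.ncard_eq_zero (Set.toFinite _), Set.diff_eq_empty] at hk
      have h1 : Set.range C.vtx ∪ {u} ⊆ Set.range B.vtx := by
        intro x hx
        by_cases hxY : x ∈ Y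
        · exact hk hxY
        · exact hsub ⟨hx, hxY⟩
      have h2 := Set.ncard_le_ncard h1 (Set.toFinite _)
      rw [hbig, ncr] at h2
      have := hlong r B
      omega
    | succ k ih =>
      intro r B hsub hk
      obtain ⟨y, hyY, hyB⟩ : (Y \ Set.range B.vtx).Nonempty := by
        rw [← Set.ncard_pos (Set.toFinite _)]; omega
      have hr : n ≤ r + 3 := by
        have h1 := Set.ncard_le_ncard hsub (Set.toFinite _)
        rw [ncr] at h1
        have h2 := Set.ncard_le_ncard_diff_add_ncard (Set.range C.vtx ∪ {u}) Y (Set.toFinite _)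
        rw [hbig] at h2
        omega
      have hdeg : n + 68 ≤ 4 * {v | v ∈ Set.range B.vtx ∧ HAdj H y v}.ncard := by
        have h1 : {v | v ∈ Set.range C.vtx ∧ HAdj H y v} ⊆
            {v | v ∈ Set.range B.vtx ∧ HAdj H y v} ∪ (Y \ {y}) := by
          rintro v ⟨hv, hadj⟩
          by_cases hvY : v ∈ Y
          · exact Or.inr ⟨hvY, fun h => hadj.1 h.symm⟩
          · exact Or.inl ⟨hsub ⟨Or.inl hv, hvY⟩, hadj⟩
        have h2 : C.dC y ≤ _ :=
          (Set.ncard_le_ncard h1 (Set.toFinite _)).trans (Set.ncard_union_le _ _)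
        have h4 := Set.ncard_diff_singleton_add_one hyY (Set.toFinite _)
        have h5 := hYdeg y hyY
        have h6 : n + 72 ≤ 4 * C.dC y := by
          have : (n : ℚ) + 72 ≤ 4 * (C.dC y : ℚ) := by linarith
          exact_mod_cast this
        omega
      obtain ⟨B', hB'⟩ := insertion hn hcard h3 hOre hr B y hyB hdeg
      refine ih (r + 1) B' ?_ ?_
      · rw [hB']
        exact hsub.trans (Set.subset_insert _ _)
      · have h1 : Y \ Set.range B'.vtx = (Y \ Set.range B.vtx) \ {y} := by
          rw [hB']
          ext x
          simp only [Set.mem_diff, Set.mem_insert_iff, Set.mem_singleton_iff]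
          tauto
        have h2 := Set.ncard_diff_singleton_add_one
          (show y ∈ Y \ Set.range B.vtx from ⟨hyY, hyB⟩) (Set.toFinite _)
        rw [h1]
        omega
  rintro ⟨t', C', hC'⟩
  exact key _ t' C' hC' rfl
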